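/- Suppose p ∈ (0,1] and q ∈ [0,1) satisfy max{p, 1−q} ≥ θ/n for a constant θ > 0, and consider a random matching algorithm satisfying the F-fair condition on an edge-Markovian evolving graph with parameters p, q, with initial discrepancy Δ ≥ 2. Let 0 < ε < 1/4 and let T_1 be any integer with T_1 ≥ (36·r/(c_*·F))·log(Δ·n/ε). Then Pr[ (max_{v∈V} Γ_{T_1}(v) ≤ μ + 1) or (max_{v∈V} Γ̄_{T_1}(v) ≤ μ̄ + 1) ] ≥ 1 − ε², where Γ̄_t(v) := K − Γ_t(v) and μ̄ := K − μ (equivalently, the second event is min_{v∈V} Γ_{T_1}(v) ≥ μ − 1). -/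

import Mathlib

open Finset

noncomputable section

/-- Rounding a real number to the nearest integer, ties rounded up: `⌈x⌋ := ⌈x - 1/2⌉`. -/
def roundNear (x : ℝ) : ℤ := ⌈x - 1 / 2⌉

/-- The degree of a vertex in a simple graph (stated without decidability assumptions). -/
def gdeg {V : Type} (G : SimpleGraph V) (v : V) : ℕ := Nat.card {u : V // G.Adj v u}

/-- The initial discrepancy `Δ = max Γ₀ - min Γ₀` of a load configuration. -/
def disc {V : Type} [Fintype V] [Nonempty V] (Γ₀ : V → ℕ) : ℕ :=
  Finset.univ.sup Γ₀ - Finset.univ.inf' Finset.univ_nonempty Γ₀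

/-- An execution of a random matching load-balancing algorithm on an edge-Markovian
evolving graph with parameters `p, q` on the vertex set `V`:
* `G t` is the (random) graph at time `t`, `M t` the random matching chosen at time `t`,
  and `Γ t` the load configuration at time `t`;
* `hist t` is the σ-algebra of events determined by the history
  `Γ_0, G_0, M_0, Γ_1, …, G_{t-1}, M_{t-1}, Γ_t` of the execution up to time `t`;
* conditionally on any (positive-probability) event determined by the history up to time `t+1`
  which determines `G t = H`, every non-edge of `H` becomes an edge of `G (t+1)` with
  probability `p`, every edge of `H` disappears with probability `q`, independently over pairs;
* for every matched pair `{v,u}` of `M t`, the loads are rebalanced to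
  `(⌈(Γ t v + Γ t u)/2⌉, ⌊(Γ t v + Γ t u)/2⌋)` or the transposed pair (each with
  probability `1/2`, which only matters when `Γ t v + Γ t u` is odd), while
  unmatched vertices keep their loads. -/
structure EMLoadProcess (V : Type) [Fintype V] [DecidableEq V] where
  Ω : Type
  [mΩ : MeasurableSpace Ω]
  μ : MeasureTheory.Measure Ω
  isProb : MeasureTheory.IsProbabilityMeasure μ
  p : ℝ
  q : ℝ
  p_pos : 0 < p
  p_le_one : p ≤ 1
  q_nonneg : 0 ≤ q
  q_lt_one : q < 1
  G : ℕ → Ω → SimpleGraph V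
  M : ℕ → Ω → Set (Sym2 V)
  Γ : ℕ → Ω → V → ℕ
  hist : ℕ → MeasurableSpace Ω
  hist_le : ∀ t, hist t ≤ mΩ
  hist_mono : Monotone hist
  meas_Γ : ∀ t, @Measurable Ω (V → ℕ) (hist t) ⊤ (Γ t)
  meas_G : ∀ t, @Measurable Ω (SimpleGraph V) (hist (t + 1)) ⊤ (G t)
  meas_M : ∀ t, @Measurable Ω (Set (Sym2 V)) (hist (t + 1)) ⊤ (M t)
  M_sub : ∀ t ω, M t ω ⊆ (G t ω).edgeSet
  M_matching : ∀ t ω, ∀ e ∈ M t ω, ∀ f ∈ M t ω, ∀ x : V, x ∈ e → x ∈ f → e = f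
  unmatched : ∀ t ω v, (∀ u : V, s(v, u) ∉ M t ω) → Γ (t + 1) ω v = Γ t ω v
  matched : ∀ t ω v u, s(v, u) ∈ M t ω →
    (Γ (t + 1) ω v = (Γ t ω v + Γ t ω u + 1) / 2 ∧ Γ (t + 1) ω u = (Γ t ω v + Γ t ω u) / 2) ∨
    (Γ (t + 1) ω v = (Γ t ω v + Γ t ω u) / 2 ∧ Γ (t + 1) ω u = (Γ t ω v + Γ t ω u + 1) / 2)
  coin : ∀ (t : ℕ) (v u : V) (E : Set Ω),
    @MeasurableSet _ (hist t ⊔ MeasurableSpace.comap (G t) ⊤ ⊔ MeasurableSpace.comap (M t) ⊤) E →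
    μ E ≠ 0 → E ⊆ {ω | s(v, u) ∈ M t ω ∧ Odd (Γ t ω v + Γ t ω u)} →
    ProbabilityTheory.cond μ E {ω | Γ (t + 1) ω v = (Γ t ω v + Γ t ω u + 1) / 2} = 1 / 2
  markov_edge : ∀ (t : ℕ) (H : SimpleGraph V) (E : Set Ω), @MeasurableSet _ (hist (t + 1)) E →
    μ E ≠ 0 → E ⊆ {ω | G t ω = H} → ∀ e : Sym2 V, ¬e.IsDiag → e ∈ H.edgeSet →
    ProbabilityTheory.cond μ E {ω | e ∈ (G (t + 1) ω).edgeSet} = ENNReal.ofReal (1 - q)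
  markov_nonedge : ∀ (t : ℕ) (H : SimpleGraph V) (E : Set Ω), @MeasurableSet _ (hist (t + 1)) E →
    μ E ≠ 0 → E ⊆ {ω | G t ω = H} → ∀ e : Sym2 V, ¬e.IsDiag → e ∉ H.edgeSet →
    ProbabilityTheory.cond μ E {ω | e ∈ (G (t + 1) ω).edgeSet} = ENNReal.ofReal p
  markov_indep : ∀ (t : ℕ) (H : SimpleGraph V) (E : Set Ω), @MeasurableSet _ (hist (t + 1)) E →
    μ E ≠ 0 → E ⊆ {ω | G t ω = H} →
    ProbabilityTheory.iIndepSet (fun e : {e : Sym2 V // ¬e.IsDiag} => {ω | (e : Sym2 V) ∈ (G (t + 1) ω).edgeSet})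
      (ProbabilityTheory.cond μ E)

/-- The `F`-fair condition: conditionally on `G t = Gr` and any (positive-probability) event
determined by the history of the execution up to time `t`, every edge `{u,v}` of `Gr` is matched
with probability at least `F / max (deg u) (deg v)`. -/
def EMLoadProcess.Fair {V : Type} [Fintype V] [DecidableEq V]
    (P : EMLoadProcess V) (F : ℝ) : Prop :=
  ∀ (t : ℕ) (Gr : SimpleGraph V) (u v : V), Gr.Adj u v →
    ∀ E : Set P.Ω, @MeasurableSet _ (P.hist t) E →
      P.μ ({ω | P.G t ω = Gr} ∩ E) ≠ 0 →
      ENNReal.ofReal (F / (max (gdeg Gr u) (gdeg Gr v) : ℝ)) ≤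
        ProbabilityTheory.cond P.μ ({ω | P.G t ω = Gr} ∩ E) {ω | s(u, v) ∈ P.M t ω}

/-- The ratio `r := max{p/(1−q), (1−q)/p}` of an edge-Markovian evolving graph. -/
def EMLoadProcess.r {V : Type} [Fintype V] [DecidableEq V] (P : EMLoadProcess V) : ℝ :=
  max (P.p / (1 - P.q)) ((1 - P.q) / P.p)

/-- The average load `μ = (Σ_v Γ₀(v))/n` of a configuration `Γ₀`. -/
def avgLoad {V : Type} [Fintype V] (Γ₀ : V → ℕ) : ℝ :=
  (∑ v : V, (Γ₀ v : ℝ)) / (Fintype.card V : ℝ)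

/-- The constant `c_* = (1 − e^{−θ/3})²/(2 + 1/θ)`. -/
noncomputable def cstar (θ : ℝ) : ℝ := (1 - Real.exp (-θ / 3)) ^ 2 / (2 + 1 / θ)

/-- Sum over all vertices of the squared excess of `g` above the threshold `A`. -/
def excess {V : Type} [Fintype V] (A : ℤ) (g : V → ℤ) : ℕ := ∑ v, (g v - A).toNat ^ 2

/-- The squared excess of `x` above `A`, counted only when `y` lies below `A`: twice the amount
guaranteed to be removed by balancing `x` with `y`. -/
def pairDrop (A x y : ℤ) : ℕ := if y < A then (x - A).toNat ^ 2 else 0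

theorem pairDrop_self (A x : ℤ) : pairDrop A x x = 0 := by
  unfold pairDrop
  split_ifs with h
  · rw [Int.toNat_of_nonpos (by omega)]; rfl
  · rfl

theorem toNat_sq_balance_of_le {A x y x' y' : ℤ} (hxy : x ≤ y) (hsum : x' + y' = x + y)
    (h₁ : x' ≤ y' + 1) (h₂ : y' ≤ x' + 1) :
    2 * ((x' - A).toNat ^ 2 + (y' - A).toNat ^ 2) + (pairDrop A x y + pairDrop A y x) ≤
      2 * ((x - A).toNat ^ 2 + (y - A).toNat ^ 2) := by
  unfold pairDrop
  obtain hy | hy := le_or_gt y A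
  · rw [Int.toNat_of_nonpos (z := x' - A) (by omega), Int.toNat_of_nonpos (z := y' - A) (by omega),
      Int.toNat_of_nonpos (z := x - A) (by omega), Int.toNat_of_nonpos (z := y - A) (by omega)]
    simp
  rw [if_neg (show ¬ y < A by omega)]
  obtain hx | hx := lt_or_ge x A
  · rw [if_pos hx, Int.toNat_of_nonpos (z := x - A) (by omega)]
    have key : 2 * ((x' - A).toNat ^ 2 + (y' - A).toNat ^ 2) ≤ (y - A).toNat ^ 2 := by
      have hc : (x' - A).toNat ≤ (y' - A).toNat + 1 := by omega
      have hd : (y' - A).toNat ≤ (x' - A).toNat + 1 := by omega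
      have hs : (x' - A).toNat + (y' - A).toNat + 1 ≤ (y - A).toNat := by omega
      generalize (x' - A).toNat = c at *
      generalize (y' - A).toNat = d at *
      generalize (y - A).toNat = a at *
      obtain rfl | rfl | rfl : c = d ∨ c = d + 1 ∨ d = c + 1 := by omega
      all_goals nlinarith
    simp only [zero_add, ne_eq, OfNat.ofNat_ne_zero, not_false_eq_true, zero_pow]
    omega
  · rw [if_neg (show ¬ x < A by omega)]
    have hc : (x' - A).toNat ≤ (y' - A).toNat + 1 := by omega
    have hd : (y' - A).toNat ≤ (x' - A).toNat + 1 := by omega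
    have hs : (x' - A).toNat + (y' - A).toNat = (x - A).toNat + (y - A).toNat := by omega
    have hle : (x - A).toNat ≤ (y - A).toNat := by omega
    generalize (x' - A).toNat = c at *
    generalize (y' - A).toNat = d at *
    generalize (y - A).toNat = a at *
    generalize (x - A).toNat = b at *
    obtain ⟨k, rfl⟩ := Nat.exists_eq_add_of_le hle
    obtain rfl | rfl | rfl : c = d ∨ c = d + 1 ∨ d = c + 1 := by omega
    · nlinarith
    · obtain _ | k := k
      · omega
      · nlinarith
    · obtain _ | k := k
      · omega
      · nlinarith

theorem toNat_sq_balance {A x y x' y' : ℤ} (hsum : x' + y' = x + y)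
    (h₁ : x' ≤ y' + 1) (h₂ : y' ≤ x' + 1) :
    2 * ((x' - A).toNat ^ 2 + (y' - A).toNat ^ 2) + (pairDrop A x y + pairDrop A y x) ≤
      2 * ((x - A).toNat ^ 2 + (y - A).toNat ^ 2) := by
  obtain h | h := le_total x y
  · exact toNat_sq_balance_of_le h hsum h₁ h₂
  · have := toNat_sq_balance_of_le (A := A) h (x' := y') (y' := x') (by omega) h₂ h₁
    omega

/-- `g'` arises from `g` by balancing every vertex with its partner under the involution `σ`. -/
structure Balances {V : Type} (σ : V → V) (g g' : V → ℤ) : Prop where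
  invol : Function.Involutive σ
  sum_eq : ∀ v, g' v + g' (σ v) = g v + g (σ v)
  le_succ : ∀ v, g' v ≤ g' (σ v) + 1

theorem Balances.neg {V : Type} {σ : V → V} {g g' : V → ℤ} (h : Balances σ g g') :
    Balances σ (-g) (-g') where
  invol := h.invol
  sum_eq v := by have := h.sum_eq v; simp only [Pi.neg_apply]; omega
  le_succ v := by
    have := h.le_succ (σ v)
    rw [h.invol v] at this
    simp only [Pi.neg_apply]
    omega

theorem Balances.excess_drop {V : Type} [Fintype V] {σ : V → V} {g g' : V → ℤ}
    (h : Balances σ g g') (A : ℤ) :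
    2 * excess A g' + ∑ v, pairDrop A (g v) (g (σ v)) ≤ 2 * excess A g := by
  have hσ (f : V → ℕ) : ∑ v, f (σ v) = ∑ v, f v := Equiv.sum_comp h.invol.toPerm f
  have hpt := Finset.sum_le_sum (s := univ) fun v _ ↦
    toNat_sq_balance (A := A) (h.sum_eq v) (h.le_succ v)
      (by have := h.le_succ (σ v); rwa [h.invol v] at this)
  have hswap : ∑ v, pairDrop A (g (σ v)) (g v) = ∑ v, pairDrop A (g v) (g (σ v)) := by
    rw [← hσ fun v ↦ pairDrop A (g v) (g (σ v))]
    exact Finset.sum_congr rfl fun v _ ↦ by rw [h.invol v]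
  simp only [Finset.sum_add_distrib, ← Finset.mul_sum] at hpt
  rw [hσ fun v ↦ (g' v - A).toNat ^ 2, hσ fun v ↦ (g v - A).toNat ^ 2, hswap] at hpt
  unfold excess
  omega

theorem sum_sum_pairDrop {V : Type} [Fintype V] (A : ℤ) (g : V → ℤ) :
    ∑ v, ∑ u, pairDrop A (g v) (g u) = #{u | g u < A} * excess A g := by
  unfold pairDrop excess
  simp only [← Finset.sum_filter, Finset.sum_const, smul_eq_mul, Finset.mul_sum]

/-- The product of the total squared excess above `m + 1` and the total squared deficit below `m`
of a load configuration. -/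
def potential {V : Type} [Fintype V] (m : ℕ) (γ : V → ℕ) : ℕ :=
  excess (m + 1) (fun v ↦ (γ v : ℤ)) * excess (-m) (-fun v ↦ (γ v : ℤ))

/-- Twice a lower bound for the loss of `potential` caused by matching `v` with `u`. -/
def potentialDrop {V : Type} [Fintype V] (m : ℕ) (γ : V → ℕ) (v u : V) : ℕ :=
  if Fintype.card V ≤ 2 * #{w | (γ w : ℤ) < m + 1} then
    pairDrop (m + 1) (γ v) (γ u) * excess (-m) (-fun v ↦ (γ v : ℤ))
  else excess (m + 1) (fun v ↦ (γ v : ℤ)) * pairDrop (-m) (-γ v) (-γ u)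

theorem potentialDrop_self {V : Type} [Fintype V] (m : ℕ) (γ : V → ℕ) (v : V) :
    potentialDrop m γ v v = 0 := by
  simp [potentialDrop, pairDrop_self]

theorem card_mul_potential_le {V : Type} [Fintype V] (m : ℕ) (γ : V → ℕ) :
    Fintype.card V * potential m γ ≤ 2 * ∑ v, ∑ u, potentialDrop m γ v u := by
  unfold potentialDrop potential
  split_ifs with h
  · have := sum_sum_pairDrop (m + 1) fun v ↦ (γ v : ℤ)
    simp only [← Finset.sum_mul, this]
    rw [← mul_assoc, ← mul_assoc, ← mul_assoc]
    gcongr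
  · have h₁ := sum_sum_pairDrop (-m) (-fun v ↦ (γ v : ℤ))
    simp only [Pi.neg_apply] at h₁
    simp only [← Finset.mul_sum, h₁]
    have h₂ := Finset.card_filter_add_card_filter_not (s := (univ : Finset V))
      (fun w ↦ (γ w : ℤ) < m + 1)
    have h₃ : #{w : V | ¬ (γ w : ℤ) < m + 1} = #{u : V | -(γ u : ℤ) < -m} := by
      congr 1; ext; simp
    rw [Finset.card_univ, h₃] at h₂
    calc _ ≤ (2 * #{u : V | -(γ u : ℤ) < -m}) * _ := Nat.mul_le_mul_right _ (by omega)
      _ = _ := by ring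

theorem Balances.potential_drop {V : Type} [Fintype V] {σ : V → V} {γ γ' : V → ℕ}
    (h : Balances σ (fun v ↦ (γ v : ℤ)) fun v ↦ (γ' v : ℤ)) (m : ℕ) :
    2 * potential m γ' + ∑ v, potentialDrop m γ v (σ v) ≤ 2 * potential m γ := by
  have hhi := h.excess_drop (m + 1)
  have hlo := h.neg.excess_drop (-m)
  unfold potentialDrop potential
  split_ifs
  · rw [← Finset.sum_mul]
    have hle := le_of_mul_le_mul_left (le_of_add_le_left hlo) two_pos
    calc _ ≤ (2 * excess (m + 1) (fun v ↦ (γ' v : ℤ)) +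
          ∑ v, pairDrop (m + 1) (γ v) (γ (σ v))) * excess (-m) (-fun v ↦ (γ v : ℤ)) := by
          rw [add_mul, mul_assoc]; gcongr
      _ ≤ _ := by rw [← mul_assoc]; gcongr
  · rw [← Finset.mul_sum]
    have hle := le_of_mul_le_mul_left (le_of_add_le_left hhi) two_pos
    calc _ ≤ excess (m + 1) (fun v ↦ (γ v : ℤ)) * (2 * excess (-m) (-fun v ↦ (γ' v : ℤ)) +
          ∑ v, pairDrop (-m) (-γ v) (-γ (σ v))) := by
          rw [mul_add, mul_left_comm]; gcongr
      _ ≤ _ := by rw [mul_left_comm]; gcongr; exact hlo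

theorem excess_eq_zero {V : Type} [Fintype V] {A : ℤ} {g : V → ℤ} (h : excess A g = 0) (v : V) :
    g v ≤ A := by
  have := (Finset.sum_eq_zero_iff.1 h) v (mem_univ v)
  have := pow_eq_zero_iff (two_ne_zero) |>.1 this
  omega

theorem excess_le {V : Type} [Fintype V] {A : ℤ} {g : V → ℤ} {D : ℕ} (h : ∀ v, g v ≤ A + D) :
    excess A g ≤ Fintype.card V * D ^ 2 := by
  calc excess A g ≤ ∑ _v : V, D ^ 2 :=
        Finset.sum_le_sum fun v _ ↦ Nat.pow_le_pow_left (by have := h v; omega) 2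
    _ = _ := by simp

open MeasureTheory ProbabilityTheory

theorem sum_ite_real_preimage {Ω' α : Type} [MeasurableSpace Ω'] [Fintype α] (ν : Measure Ω')
    [IsFiniteMeasure ν] (X : Ω' → α) (hX : ∀ a, MeasurableSet (X ⁻¹' {a})) (Q : α → Prop)
    [DecidablePred Q] :
    ∑ a, (if Q a then ν.real (X ⁻¹' {a}) else 0) = ν.real {ω | Q (X ω)} := by
  rw [← Finset.sum_filter, sum_measureReal_preimage_singleton _ fun a _ ↦ hX a]
  congr 1
  ext
  simp

theorem gdeg_add_gdeg {V : Type} [Fintype V] [DecidableEq V] (Gr : SimpleGraph V)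
    [DecidableRel Gr.Adj] {u v : V} (h : Gr.Adj u v) :
    (gdeg Gr u + gdeg Gr v : ℝ) =
      2 + ∑ w ∈ {u, v}ᶜ, ((if Gr.Adj u w then 1 else 0) + (if Gr.Adj v w then 1 else 0) : ℝ) := by
  have hdeg (x : V) : (gdeg Gr x : ℝ) = ∑ w, if Gr.Adj x w then 1 else 0 := by
    rw [gdeg, Nat.card_eq_fintype_card, Fintype.card_subtype]
    simp
  rw [hdeg, hdeg, ← Finset.sum_add_distrib, ← Finset.sum_add_sum_compl {u, v},
    Finset.sum_pair h.ne]
  simp [h, h.symm, one_add_one_eq_two]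

/-- Lower bound for the expected reciprocal of the larger of two degrees, restricted to the event
that `u` and `v` are adjacent, for a random graph given by weights `w`. -/
theorem le_sum_div_max_gdeg {V : Type} [Fintype V] [DecidableEq V] {u v : V}
    [∀ Gr : SimpleGraph V, DecidableRel Gr.Adj] (w : SimpleGraph V → ℝ) (hw : ∀ Gr, 0 ≤ w Gr)
    {a b : ℝ} (hb : 0 ≤ b) (ha0 : 0 ≤ a)
    (ha : ∑ Gr : SimpleGraph V, (if Gr.Adj u v then w Gr else 0) = a)
    (hu : ∀ x, x ≠ u → x ≠ v →
      ∑ Gr : SimpleGraph V, (if Gr.Adj u v ∧ Gr.Adj u x then w Gr else 0) ≤ a * b)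
    (hv : ∀ x, x ≠ u → x ≠ v →
      ∑ Gr : SimpleGraph V, (if Gr.Adj u v ∧ Gr.Adj v x then w Gr else 0) ≤ a * b) :
    a / (2 + 2 * Fintype.card V * b) ≤
      ∑ Gr : SimpleGraph V, if Gr.Adj u v then w Gr / max (gdeg Gr u : ℝ) (gdeg Gr v) else 0 := by
  set C : ℝ := 2 + 2 * Fintype.card V * b with hC
  have hCpos : 0 < C := by positivity
  have hterm (Gr : SimpleGraph V) :
      2 / C * (if Gr.Adj u v then w Gr else 0) - 1 / C ^ 2 *
        (2 * (if Gr.Adj u v then w Gr else 0) + ∑ x ∈ {u, v}ᶜ,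
          ((if Gr.Adj u v ∧ Gr.Adj u x then w Gr else 0) +
            (if Gr.Adj u v ∧ Gr.Adj v x then w Gr else 0))) ≤
      if Gr.Adj u v then w Gr / max (gdeg Gr u : ℝ) (gdeg Gr v) else 0 := by
    by_cases h : Gr.Adj u v
    swap
    · simp [h]
    have hsum := gdeg_add_gdeg Gr h
    set S : ℝ := gdeg Gr u + gdeg Gr v with hS
    have hmul : 2 * w Gr + ∑ x ∈ {u, v}ᶜ,
          ((if Gr.Adj u x then w Gr else 0) + (if Gr.Adj v x then w Gr else 0)) = w Gr * S := by
      rw [hsum, mul_add, Finset.mul_sum, mul_comm]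
      simp only [mul_add, mul_ite, mul_one, mul_zero]
    simp only [h, true_and, if_true]
    rw [hmul]
    have hS2 : 2 ≤ S := by
      rw [hsum]
      have : (0 : ℝ) ≤ ∑ w ∈ {u, v}ᶜ,
        ((if Gr.Adj u w then 1 else 0) + (if Gr.Adj v w then 1 else 0) : ℝ) :=
        Finset.sum_nonneg fun _ _ ↦ by positivity
      linarith
    have hpos (x y : V) (hxy : Gr.Adj x y) : (0 : ℝ) < gdeg Gr x := by
      have : Nonempty {z // Gr.Adj x z} := ⟨⟨y, hxy⟩⟩
      exact_mod_cast (Nat.card_pos : 0 < Nat.card {z // Gr.Adj x z})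
    have hmax : max (gdeg Gr u : ℝ) (gdeg Gr v) ≤ S :=
      max_le (by linarith [hpos v u h.symm]) (by linarith [hpos u v h])
    have htan : 2 / C - 1 / C ^ 2 * S ≤ 1 / S := by
      have : 1 / S - (2 / C - 1 / C ^ 2 * S) = (C - S) ^ 2 / (C ^ 2 * S) := by
        field_simp
        ring
      have : 0 ≤ (C - S) ^ 2 / (C ^ 2 * S) := by positivity
      linarith
    calc _ = w Gr * (2 / C - 1 / C ^ 2 * S) := by ring
      _ ≤ w Gr * (1 / S) := mul_le_mul_of_nonneg_left htan (hw Gr)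
      _ = w Gr / S := by ring
      _ ≤ _ := div_le_div_of_nonneg_left (hw Gr) (lt_max_of_lt_left (hpos u v h)) hmax
  refine le_trans ?_ (Finset.sum_le_sum fun Gr _ ↦ hterm Gr)
  rw [Finset.sum_sub_distrib, ← Finset.mul_sum, ← Finset.mul_sum, Finset.sum_add_distrib,
    ← Finset.mul_sum, Finset.sum_comm, ha]
  have hrest : ∑ x ∈ ({u, v} : Finset V)ᶜ, ∑ Gr : SimpleGraph V,
      ((if Gr.Adj u v ∧ Gr.Adj u x then w Gr else 0) +
        (if Gr.Adj u v ∧ Gr.Adj v x then w Gr else 0)) ≤ Fintype.card V * (2 * (a * b)) := by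
    calc _ ≤ ∑ x ∈ ({u, v} : Finset V)ᶜ, 2 * (a * b) := by
          refine Finset.sum_le_sum fun x hx ↦ ?_
          simp only [mem_compl, mem_insert, mem_singleton, not_or] at hx
          rw [Finset.sum_add_distrib]
          linarith [hu x hx.1 hx.2, hv x hx.1 hx.2]
      _ = #({u, v} : Finset V)ᶜ * (2 * (a * b)) := by simp
      _ ≤ _ := by gcongr; exact Finset.card_le_univ _
  have h2 : 1 / C ^ 2 * (2 * a + ∑ x ∈ ({u, v} : Finset V)ᶜ, ∑ Gr : SimpleGraph V,
      ((if Gr.Adj u v ∧ Gr.Adj u x then w Gr else 0) +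
        (if Gr.Adj u v ∧ Gr.Adj v x then w Gr else 0))) ≤ 1 / C ^ 2 * (a * C) := by
    gcongr
    rw [hC]
    linarith
  have h3 : 1 / C ^ 2 * (a * C) = a / C := by field_simp
  have h4 : 2 / C * a = 2 * (a / C) := by ring
  linarith

namespace EMLoadProcess

attribute [instance] EMLoadProcess.mΩ EMLoadProcess.isProb

variable {V : Type} [Fintype V] [DecidableEq V] (P : EMLoadProcess V)

theorem exists_balances (t : ℕ) (ω : P.Ω) :
    ∃ σ : V → V, Balances σ (fun v ↦ (P.Γ t ω v : ℤ)) (fun v ↦ (P.Γ (t + 1) ω v : ℤ)) ∧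
      ∀ v u, s(v, u) ∈ P.M t ω ↔ σ v = u ∧ v ≠ u := by
  have hne {v u : V} (h : s(v, u) ∈ P.M t ω) : v ≠ u :=
    ((SimpleGraph.mem_edgeSet _).1 (P.M_sub t ω h)).ne
  have hex (v : V) : ∃ w, ∀ u, s(v, u) ∈ P.M t ω ↔ w = u ∧ v ≠ u := by
    by_cases h : ∃ w, s(v, w) ∈ P.M t ω
    · obtain ⟨w, hw⟩ := h
      refine ⟨w, fun u ↦ ⟨fun hu ↦ ⟨?_, hne hu⟩, fun hu ↦ hu.1 ▸ hw⟩⟩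
      exact Sym2.congr_right.1 (P.M_matching t ω _ hw _ hu v (by simp) (by simp))
    · push Not at h
      exact ⟨v, fun u ↦ ⟨fun hu ↦ absurd hu (h u), fun hu ↦ absurd hu.1 hu.2⟩⟩
  choose σ hσ using hex
  have hmem {v : V} (h : σ v ≠ v) : s(v, σ v) ∈ P.M t ω := (hσ v _).2 ⟨rfl, h.symm⟩
  have hstay {v : V} (h : σ v = v) : P.Γ (t + 1) ω v = P.Γ t ω v :=
    P.unmatched t ω v fun u hu ↦ ((hσ v u).1 hu).2 (h ▸ ((hσ v u).1 hu).1)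
  refine ⟨σ, ⟨fun v ↦ ?_, fun v ↦ ?_, fun v ↦ ?_⟩, hσ⟩
  · by_cases h : σ v = v
    · rw [h, h]
    · exact ((hσ (σ v) v).1 (Sym2.eq_swap ▸ hmem h)).1
  · by_cases h : σ v = v
    · simp only [h, hstay h]
    · have := P.matched t ω v (σ v) (hmem h)
      omega
  · by_cases h : σ v = v
    · simp only [h]
      omega
    · have := P.matched t ω v (σ v) (hmem h)
      omega

open Classical in
theorem potential_drop (m t : ℕ) (ω : P.Ω) :
    2 * potential m (P.Γ (t + 1) ω) +
      ∑ v, ∑ u, (if s(v, u) ∈ P.M t ω then potentialDrop m (P.Γ t ω) v u else 0) ≤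
      2 * potential m (P.Γ t ω) := by
  obtain ⟨σ, hbal, hσ⟩ := P.exists_balances t ω
  convert hbal.potential_drop m using 3 with v
  simp only [hσ]
  rw [Finset.sum_eq_single (σ v)]
  · split_ifs with h
    · rfl
    · have h' : σ v = v := by tauto
      rw [h', potentialDrop_self]
  · intro u _ hu
    rw [if_neg fun h ↦ hu h.1.symm]
  · simp

theorem measurableSet_graph (t : ℕ) (S : Set (SimpleGraph V)) :
    MeasurableSet[P.hist (t + 1)] (P.G t ⁻¹' S) :=
  P.meas_G t (MeasurableSpace.measurableSet_top)

theorem measurableSet_matched (t : ℕ) (e : Sym2 V) :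
    MeasurableSet {ω | e ∈ P.M t ω} :=
  P.hist_le (t + 1) _ (show MeasurableSet[P.hist (t + 1)] (P.M t ⁻¹' {N | e ∈ N}) from
    P.meas_M t MeasurableSpace.measurableSet_top)

theorem measurable_load (t : ℕ) (f : (V → ℕ) → ENNReal) :
    Measurable[P.hist t] fun ω ↦ f (P.Γ t ω) :=
  fun s _ ↦ show MeasurableSet[P.hist t] (P.Γ t ⁻¹' (f ⁻¹' s)) from
    P.meas_Γ t MeasurableSpace.measurableSet_top

/-- The smaller of the two probabilities that a pair is an edge, given whether it was one before,
times the fairness parameter, over an upper bound for the expected sum of two degrees. -/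
def matchRate (F : ℝ) : ℝ :=
  F * min P.p (1 - P.q) / (2 + 2 * Fintype.card V * max P.p (1 - P.q))

theorem matchRate_nonneg {F : ℝ} (hF : 0 ≤ F) : 0 ≤ P.matchRate F := by
  have h₁ := P.p_pos
  have h₂ := P.q_lt_one
  have : 0 ≤ min P.p (1 - P.q) := le_min h₁.le (by linarith)
  have : 0 ≤ max P.p (1 - P.q) := le_max_of_le_left h₁.le
  unfold matchRate
  positivity

theorem cond_real_edge {t : ℕ} {H : SimpleGraph V} {E : Set P.Ω}
    (hE : MeasurableSet[P.hist (t + 1)] E) (hE0 : P.μ E ≠ 0) (hEH : E ⊆ {ω | P.G t ω = H})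
    {x y : V} (hxy : x ≠ y) :
    P.μ[|E].real {ω | (P.G (t + 1) ω).Adj x y} ∈
      Set.Icc (min P.p (1 - P.q)) (max P.p (1 - P.q)) := by
  have h₁ := P.p_pos
  have h₂ := P.q_lt_one
  have hd : ¬ s(x, y).IsDiag := by simpa using hxy
  simp only [measureReal_def, ← SimpleGraph.mem_edgeSet]
  by_cases h : s(x, y) ∈ H.edgeSet
  · rw [P.markov_edge t H E hE hE0 hEH _ hd h, ENNReal.toReal_ofReal (by linarith)]
    exact ⟨min_le_right _ _, le_max_right _ _⟩
  · rw [P.markov_nonedge t H E hE hE0 hEH _ hd h, ENNReal.toReal_ofReal h₁.le]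
    exact ⟨min_le_left _ _, le_max_left _ _⟩

theorem cond_real_edge_inter {t : ℕ} {H : SimpleGraph V} {E : Set P.Ω}
    (hE : MeasurableSet[P.hist (t + 1)] E) (hE0 : P.μ E ≠ 0) (hEH : E ⊆ {ω | P.G t ω = H})
    {x y z w : V} (hxy : x ≠ y) (hzw : z ≠ w) (hne : s(x, y) ≠ s(z, w)) :
    P.μ[|E].real {ω | (P.G (t + 1) ω).Adj x y ∧ (P.G (t + 1) ω).Adj z w} =
      P.μ[|E].real {ω | (P.G (t + 1) ω).Adj x y} *
        P.μ[|E].real {ω | (P.G (t + 1) ω).Adj z w} := by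
  let e : {e : Sym2 V // ¬ e.IsDiag} := ⟨s(x, y), by simpa using hxy⟩
  let f : {e : Sym2 V // ¬ e.IsDiag} := ⟨s(z, w), by simpa using hzw⟩
  have hef : e ≠ f := fun h ↦ hne (congrArg Subtype.val h)
  have := (P.markov_indep t H E hE hE0 hEH).meas_biInter {e, f}
  rw [Finset.prod_pair hef, Finset.set_biInter_insert, Finset.set_biInter_singleton] at this
  simp only [measureReal_def, ← SimpleGraph.mem_edgeSet]
  rw [← ENNReal.toReal_mul, ← this]
  rfl

theorem real_matched_of_subset {F : ℝ} (hF : 0 < F) (hfair : P.Fair F) {t : ℕ}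
    {H : SimpleGraph V} {E : Set P.Ω} (hE : MeasurableSet[P.hist (t + 1)] E)
    (hEH : E ⊆ {ω | P.G t ω = H}) {u v : V} (huv : u ≠ v) :
    P.matchRate F * P.μ.real E ≤ P.μ.real (E ∩ {ω | s(u, v) ∈ P.M (t + 1) ω}) := by
  classical
  by_cases hE0 : P.μ E = 0
  · simp [measureReal_def, hE0]
  set S : Set P.Ω := {ω | s(u, v) ∈ P.M (t + 1) ω} with hS
  have hSm : MeasurableSet S := P.measurableSet_matched _ _
  have hEm : MeasurableSet E := P.hist_le _ _ hE
  have hEpos : 0 < P.μ.real E := ENNReal.toReal_pos hE0 (measure_ne_top _ _)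
  have hcond (B : Set P.Ω) : P.μ[|E].real B = P.μ.real (E ∩ B) / P.μ.real E := by
    rw [measureReal_def, cond_apply hEm, ENNReal.toReal_mul, ENNReal.toReal_inv]
    simp only [measureReal_def]
    ring
  have hGm (Gr : SimpleGraph V) : MeasurableSet (P.G (t + 1) ⁻¹' {Gr}) :=
    P.hist_le _ _ (P.measurableSet_graph _ _)
  set ν := P.μ[|E] with hν
  have : IsProbabilityMeasure ν := cond_isProbabilityMeasure hE0
  have hp := P.p_pos
  set b := max P.p (1 - P.q) with hb
  have hb0 : 0 ≤ b := le_max_of_le_left hp.le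
  set a := ν.real {ω | (P.G (t + 1) ω).Adj u v} with ha
  have hbound (y : V) (hy : y = u ∨ y = v) (x : V) (hxu : x ≠ u) (hxv : x ≠ v) :
      ∑ Gr : SimpleGraph V,
        (if Gr.Adj u v ∧ Gr.Adj y x then ν.real (P.G (t + 1) ⁻¹' {Gr}) else 0) ≤ a * b := by
    rw [sum_ite_real_preimage ν (P.G (t + 1)) hGm fun Gr ↦ Gr.Adj u v ∧ Gr.Adj y x]
    have hyx : y ≠ x := by rintro rfl; tauto
    rw [P.cond_real_edge_inter hE hE0 hEH huv hyx (by
      intro h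
      have : x ∈ s(u, v) := h ▸ Sym2.mem_mk_right y x
      rw [Sym2.mem_iff] at this
      tauto)]
    exact mul_le_mul_of_nonneg_left (P.cond_real_edge hE hE0 hEH hyx).2 measureReal_nonneg
  have hmain := le_sum_div_max_gdeg (u := u) (v := v)
    (fun Gr ↦ ν.real (P.G (t + 1) ⁻¹' {Gr})) (fun _ ↦ measureReal_nonneg) hb0
    (measureReal_nonneg : 0 ≤ a)
    (sum_ite_real_preimage ν (P.G (t + 1)) hGm fun Gr ↦ Gr.Adj u v)
    (hbound u (Or.inl rfl)) (hbound v (Or.inr rfl))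
  have hfair' (Gr : SimpleGraph V) (h : Gr.Adj u v) :
      F * (ν.real (P.G (t + 1) ⁻¹' {Gr}) / max (gdeg Gr u : ℝ) (gdeg Gr v)) ≤
        (ν.restrict S).real (P.G (t + 1) ⁻¹' {Gr}) := by
    rw [measureReal_restrict_apply (hGm Gr), hcond, hcond]
    set B : Set P.Ω := {ω | P.G (t + 1) ω = Gr} ∩ E with hB
    have hBm : MeasurableSet B := (hGm Gr).inter hEm
    have hB1 : E ∩ P.G (t + 1) ⁻¹' {Gr} = B := Set.inter_comm _ _
    have hB2 : E ∩ (P.G (t + 1) ⁻¹' {Gr} ∩ S) = B ∩ S := by rw [← Set.inter_assoc, hB1]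
    rw [hB1, hB2]
    by_cases hB0 : P.μ B = 0
    · have hz : P.μ.real B = 0 := by simp [measureReal_def, hB0]
      rw [hz]
      simp only [zero_div, mul_zero]
      positivity
    have hBpos : 0 < P.μ.real B := ENNReal.toReal_pos hB0 (measure_ne_top _ _)
    have hf := hfair (t + 1) Gr u v h E hE hB0
    have : IsProbabilityMeasure P.μ[|B] := cond_isProbabilityMeasure hB0
    rw [ENNReal.ofReal_le_iff_le_toReal (measure_ne_top _ _), cond_apply hBm, ENNReal.toReal_mul,
      ENNReal.toReal_inv] at hf
    change F / _ ≤ (P.μ.real B)⁻¹ * P.μ.real (B ∩ S) at hf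
    rw [← div_eq_inv_mul, le_div_iff₀ hBpos] at hf
    calc _ = F / max (gdeg Gr u : ℝ) (gdeg Gr v) * P.μ.real B / P.μ.real E := by ring
      _ ≤ _ := by gcongr
  have hle : F * (a / (2 + 2 * Fintype.card V * b)) ≤ ν.real S := by
    calc _ ≤ F * _ := mul_le_mul_of_nonneg_left hmain hF.le
      _ ≤ ∑ Gr : SimpleGraph V,
          (if Gr.Adj u v then (ν.restrict S).real (P.G (t + 1) ⁻¹' {Gr}) else 0) := by
        rw [Finset.mul_sum]
        refine Finset.sum_le_sum fun Gr _ ↦ ?_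
        split_ifs with h
        · exact hfair' Gr h
        · simp
      _ = (ν.restrict S).real {ω | (P.G (t + 1) ω).Adj u v} :=
        sum_ite_real_preimage _ _ hGm fun Gr ↦ Gr.Adj u v
      _ ≤ (ν.restrict S).real Set.univ := measureReal_mono (Set.subset_univ _)
      _ = ν.real S := by rw [measureReal_restrict_apply MeasurableSet.univ, Set.univ_inter]
  rw [hcond, le_div_iff₀ hEpos] at hle
  refine le_trans ?_ hle
  refine mul_le_mul_of_nonneg_right ?_ hEpos.le
  rw [matchRate, mul_div_assoc]
  have := (P.cond_real_edge hE hE0 hEH huv).1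
  gcongr

theorem real_matched {F : ℝ} (hF : 0 < F) (hfair : P.Fair F) {t : ℕ}
    {E : Set P.Ω} (hE : MeasurableSet[P.hist (t + 1)] E) {u v : V} (huv : u ≠ v) :
    P.matchRate F * P.μ.real E ≤ P.μ.real (E ∩ {ω | s(u, v) ∈ P.M (t + 1) ω}) := by
  have hGm (Gr : SimpleGraph V) : MeasurableSet (P.G t ⁻¹' {Gr}) :=
    P.hist_le _ _ (P.measurableSet_graph _ _)
  have hsplit (B : Set P.Ω) :
      ∑ H : SimpleGraph V, P.μ.real (P.G t ⁻¹' {H} ∩ B) = P.μ.real B := by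
    simpa [measureReal_restrict_apply (hGm _), measureReal_restrict_apply MeasurableSet.univ]
      using sum_ite_real_preimage (P.μ.restrict B) (P.G t) hGm fun _ ↦ True
  rw [← hsplit E, ← hsplit (E ∩ _), Finset.mul_sum]
  refine Finset.sum_le_sum fun H _ ↦ ?_
  rw [← Set.inter_assoc]
  exact P.real_matched_of_subset hF hfair
    (MeasurableSet.inter (P.measurableSet_graph t {H}) hE) Set.inter_subset_left huv

theorem lintegral_matched {F : ℝ} (hF : 0 < F) (hfair : P.Fair F) {t : ℕ} {u v : V} (huv : u ≠ v)
    {X : P.Ω → ENNReal} (hX : Measurable[P.hist (t + 1)] X) :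
    ENNReal.ofReal (P.matchRate F) * ∫⁻ ω, X ω ∂P.μ ≤
      ∫⁻ ω in {ω | s(u, v) ∈ P.M (t + 1) ω}, X ω ∂P.μ := by
  set S : Set P.Ω := {ω | s(u, v) ∈ P.M (t + 1) ω} with hS
  have hle : ENNReal.ofReal (P.matchRate F) • P.μ.trim (P.hist_le (t + 1)) ≤
      (P.μ.restrict S).trim (P.hist_le (t + 1)) := by
    rw [Measure.le_iff]
    intro E hE
    rw [Measure.smul_apply, smul_eq_mul, trim_measurableSet_eq _ hE, trim_measurableSet_eq _ hE,
      Measure.restrict_apply (P.hist_le _ _ hE), ← ofReal_measureReal (μ := P.μ) (s := E),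
      ← ofReal_measureReal (μ := P.μ) (s := E ∩ S),
      ← ENNReal.ofReal_mul (P.matchRate_nonneg hF.le)]
    exact ENNReal.ofReal_le_ofReal (P.real_matched hF hfair hE huv)
  have := lintegral_mono' hle (le_refl X)
  rwa [lintegral_smul_measure, lintegral_trim _ hX, lintegral_trim _ hX] at this

theorem potential_antitone (m : ℕ) (ω : P.Ω) : Antitone fun t ↦ potential m (P.Γ t ω) :=
  antitone_nat_of_succ_le fun t ↦ by
    have := P.potential_drop m t ω
    omega

/-- The expected value of `potential` at time `t`. -/
def meanPotential (m t : ℕ) : ENNReal := ∫⁻ ω, (potential m (P.Γ t ω) : ENNReal) ∂P.μ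

theorem meanPotential_le {Γ₀ : V → ℕ} (h0 : ∀ ω, P.Γ 0 ω = Γ₀) (m t : ℕ) :
    P.meanPotential m t ≤ potential m Γ₀ := by
  calc _ ≤ ∫⁻ _ω, (potential m Γ₀ : ENNReal) ∂P.μ := by
        refine lintegral_mono fun ω ↦ ?_
        have h : potential m (P.Γ t ω) ≤ potential m (P.Γ 0 ω) :=
          P.potential_antitone m ω t.zero_le
        rw [h0 ω] at h
        exact Nat.cast_le.2 h
    _ = _ := by simp

theorem meanPotential_succ {F : ℝ} (hF : 0 < F) (hfair : P.Fair F) (m t : ℕ) :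
    4 * P.meanPotential m (t + 2) + ENNReal.ofReal (P.matchRate F) *
      (Fintype.card V * P.meanPotential m (t + 1)) ≤ 4 * P.meanPotential m (t + 1) := by
  classical
  have hmeas (s : ℕ) (f : (V → ℕ) → ENNReal) : Measurable fun ω ↦ f (P.Γ s ω) :=
    (P.measurable_load s f).mono (P.hist_le s) le_rfl
  set ρ := ENNReal.ofReal (P.matchRate F)
  set W : V → V → P.Ω → ENNReal := fun v u ω ↦ (potentialDrop m (P.Γ (t + 1) ω) v u : ENNReal)
    with hW
  set S : V → V → Set P.Ω := fun v u ↦ {ω | s(v, u) ∈ P.M (t + 1) ω} with hS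
  have hWm (v u : V) : Measurable (W v u) := hmeas (t + 1) fun γ ↦ (potentialDrop m γ v u : ENNReal)
  have hSm (v u : V) : MeasurableSet (S v u) := P.measurableSet_matched _ _
  have hWS (v u : V) : Measurable ((S v u).indicator (W v u)) := (hWm v u).indicator (hSm v u)
  have hdrop : 2 * P.meanPotential m (t + 2) + ∑ v, ∑ u, ∫⁻ ω in S v u, W v u ω ∂P.μ ≤
      2 * P.meanPotential m (t + 1) := by
    unfold meanPotential
    simp only [← lintegral_indicator (hSm _ _)]
    simp only [← lintegral_finsetSum univ fun u _ ↦ hWS _ u]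
    rw [← lintegral_finsetSum univ fun v _ ↦ Finset.measurable_sum univ fun u _ ↦ hWS v u,
      ← lintegral_const_mul _ (hmeas _ fun γ ↦ (potential m γ : ENNReal)),
      ← lintegral_const_mul _ (hmeas _ fun γ ↦ (potential m γ : ENNReal)),
      ← lintegral_add_left ((hmeas _ fun γ ↦ (potential m γ : ENNReal)).const_mul 2)]
    refine lintegral_mono fun ω ↦ ?_
    have := P.potential_drop m (t + 1) ω
    simp only [Set.indicator_apply, hW, hS, Set.mem_ofPred_eq]
    exact_mod_cast this
  have hpair (v u : V) : ρ * ∫⁻ ω, W v u ω ∂P.μ ≤ ∫⁻ ω in S v u, W v u ω ∂P.μ := by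
    by_cases h : v = u
    · subst h
      simp [hW, potentialDrop_self]
    · exact P.lintegral_matched hF hfair h
        (P.measurable_load (t + 1) fun γ ↦ (potentialDrop m γ v u : ENNReal))
  have hcard : Fintype.card V * P.meanPotential m (t + 1) ≤
      2 * ∑ v, ∑ u, ∫⁻ ω, W v u ω ∂P.μ := by
    unfold meanPotential
    simp only [← lintegral_finsetSum univ fun u _ ↦ hWm _ u]
    rw [← lintegral_finsetSum univ fun v _ ↦ Finset.measurable_sum univ fun u _ ↦ hWm v u,
      ← lintegral_const_mul _ (hmeas _ fun γ ↦ (potential m γ : ENNReal)),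
      ← lintegral_const_mul _ (Finset.measurable_sum univ fun v _ ↦
        Finset.measurable_sum univ fun u _ ↦ hWm v u)]
    refine lintegral_mono fun ω ↦ ?_
    have := card_mul_potential_le m (P.Γ (t + 1) ω)
    simp only [hW]
    exact_mod_cast this
  calc 4 * P.meanPotential m (t + 2) + ρ * (Fintype.card V * P.meanPotential m (t + 1))
      ≤ 4 * P.meanPotential m (t + 2) + ρ * (2 * ∑ v, ∑ u, ∫⁻ ω, W v u ω ∂P.μ) := by gcongr
    _ = 2 * (2 * P.meanPotential m (t + 2) + ∑ v, ∑ u, ρ * ∫⁻ ω, W v u ω ∂P.μ) := by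
      simp only [← Finset.mul_sum]
      ring
    _ ≤ 2 * (2 * P.meanPotential m (t + 1)) := by
      refine mul_le_mul_right (le_trans ?_ hdrop) 2
      gcongr with v _ u _
      exact hpair v u
    _ = _ := by ring

theorem toReal_meanPotential_le {F κ : ℝ} (hF : 0 < F) (hfair : P.Fair F)
    (hκ : 4 * κ ≤ Fintype.card V * P.matchRate F) (hκ1 : κ ≤ 1) {Γ₀ : V → ℕ}
    (h0 : ∀ ω, P.Γ 0 ω = Γ₀) (m t : ℕ) :
    (P.meanPotential m (t + 1)).toReal ≤ (1 - κ) ^ t * potential m Γ₀ := by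
  have hfin (s : ℕ) : P.meanPotential m s ≠ ⊤ :=
    ne_top_of_le_ne_top (ENNReal.natCast_ne_top _) (P.meanPotential_le h0 m s)
  induction t with
  | zero =>
    have := ENNReal.toReal_mono (ENNReal.natCast_ne_top _) (P.meanPotential_le h0 m 1)
    simpa using this
  | succ t ih =>
    have h := P.meanPotential_succ hF hfair m t
    have hr := ENNReal.toReal_mono (ENNReal.mul_ne_top (by simp) (hfin _)) h
    have hfin1 := hfin (t + 1)
    rw [ENNReal.toReal_add (ENNReal.mul_ne_top (by simp) (hfin _))
      (ENNReal.mul_ne_top ENNReal.ofReal_ne_top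
        (ENNReal.mul_ne_top (ENNReal.natCast_ne_top _) hfin1))] at hr
    simp only [ENNReal.toReal_mul, ENNReal.toReal_ofReal (P.matchRate_nonneg hF.le),
      ENNReal.toReal_natCast, ENNReal.toReal_ofNat] at hr
    have hnn : 0 ≤ (P.meanPotential m (t + 1)).toReal := ENNReal.toReal_nonneg
    have hmul := mul_le_mul_of_nonneg_right hκ hnn
    calc (P.meanPotential m (t + 1 + 1)).toReal
        ≤ (1 - κ) * (P.meanPotential m (t + 1)).toReal := by
          change (P.meanPotential m (t + 2)).toReal ≤ _
          linarith
      _ ≤ (1 - κ) * ((1 - κ) ^ t * potential m Γ₀) :=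
          mul_le_mul_of_nonneg_left ih (by linarith)
      _ = _ := by ring

theorem r_eq : P.r = max P.p (1 - P.q) / min P.p (1 - P.q) := by
  have h₁ := P.p_pos
  have h₂ : 0 < 1 - P.q := by linarith [P.q_lt_one]
  unfold EMLoadProcess.r
  obtain h | h := le_total P.p (1 - P.q)
  · rw [max_eq_right h, min_eq_left h, max_eq_right]
    exact ((div_le_one h₂).2 h).trans ((one_le_div h₁).2 h)
  · rw [max_eq_left h, min_eq_right h, max_eq_left]
    exact ((div_le_one h₁).2 h).trans ((one_le_div h₂).2 h)

theorem one_le_r : 1 ≤ P.r := by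
  rw [P.r_eq, one_le_div (lt_min P.p_pos (by linarith [P.q_lt_one]))]
  exact min_le_max

end EMLoadProcess

theorem cstar_pos {θ : ℝ} (hθ : 0 < θ) : 0 < cstar θ := by
  have : Real.exp (-θ / 3) < 1 := Real.exp_lt_one_iff.2 (by linarith)
  have : 0 < 1 - Real.exp (-θ / 3) := by linarith
  unfold cstar
  positivity

theorem cstar_le {θ : ℝ} (hθ : 0 < θ) : cstar θ ≤ 1 / (2 + 1 / θ) := by
  have h₁ : Real.exp (-θ / 3) < 1 := Real.exp_lt_one_iff.2 (by linarith)
  have h₂ := Real.exp_pos (-θ / 3)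
  unfold cstar
  gcongr
  nlinarith

theorem EMLoadProcess.le_card_mul_matchRate {V : Type} [Fintype V] [DecidableEq V] [Nonempty V]
    (P : EMLoadProcess V) {θ F : ℝ} (hθ : 0 < θ) (hF : 0 < F)
    (hθn : θ / (Fintype.card V : ℝ) ≤ max P.p (1 - P.q)) :
    4 * (cstar θ * F / (8 * P.r)) ≤ Fintype.card V * P.matchRate F := by
  have hx : 0 < min P.p (1 - P.q) := lt_min P.p_pos (by linarith [P.q_lt_one])
  have hy : 0 < max P.p (1 - P.q) := hx.trans_le min_le_max
  rw [P.r_eq, EMLoadProcess.matchRate]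
  have hn : (0 : ℝ) < Fintype.card V := by exact_mod_cast Fintype.card_pos
  rw [div_le_iff₀ hn] at hθn
  generalize max P.p (1 - P.q) = y at *
  generalize min P.p (1 - P.q) = x at *
  generalize (Fintype.card V : ℝ) = n at *
  have hc : cstar θ ≤ n * y / (1 + n * y) := by
    calc _ ≤ 1 / (2 + 1 / θ) := cstar_le hθ
      _ = θ / (2 * θ + 1) := by field_simp
      _ ≤ n * y / (1 + n * y) := by
        rw [div_le_div_iff₀ (by positivity) (by positivity)]
        nlinarith [mul_pos hn hy, mul_pos hθ (mul_pos hn hy)]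
  calc 4 * (cstar θ * F / (8 * (y / x))) = F * x / (2 * y) * cstar θ := by
        field_simp
        ring
    _ ≤ F * x / (2 * y) * (n * y / (1 + n * y)) := by gcongr
    _ = n * (F * x / (2 + 2 * n * y)) := by
        field_simp

theorem le_min_add_disc {V : Type} [Fintype V] [Nonempty V] (γ : V → ℕ) (v u : V) :
    γ v ≤ γ u + disc γ := by
  have h₁ : γ v ≤ univ.sup γ := Finset.le_sup (mem_univ v)
  have h₂ : univ.inf' univ_nonempty γ ≤ γ u := Finset.inf'_le γ (mem_univ u)
  unfold disc
  omega

theorem potential_floor_avgLoad_le {V : Type} [Fintype V] [Nonempty V] (γ : V → ℕ) :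
    potential ⌊avgLoad γ⌋₊ γ ≤ Fintype.card V ^ 2 * disc γ ^ 4 := by
  have hn : (0 : ℝ) < Fintype.card V := by exact_mod_cast Fintype.card_pos
  have hupper (v : V) : γ v ≤ ⌊avgLoad γ⌋₊ + disc γ := by
    suffices h : γ v - disc γ ≤ ⌊avgLoad γ⌋₊ by omega
    apply Nat.le_floor
    rw [avgLoad, le_div_iff₀ hn]
    have := Finset.card_nsmul_le_sum univ γ (γ v - disc γ) fun u _ ↦ by
      have := le_min_add_disc γ v u
      omega
    rw [smul_eq_mul, Finset.card_univ, mul_comm] at this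
    exact_mod_cast this
  have hlower (v : V) : ⌊avgLoad γ⌋₊ ≤ γ v + disc γ := by
    apply Nat.floor_le_of_le
    rw [avgLoad, div_le_iff₀ hn]
    have := Finset.sum_le_card_nsmul univ γ (γ v + disc γ) fun u _ ↦ le_min_add_disc γ u v
    rw [smul_eq_mul, Finset.card_univ, mul_comm] at this
    exact_mod_cast this
  calc _ ≤ (Fintype.card V * disc γ ^ 2) * (Fintype.card V * disc γ ^ 2) := by
        refine Nat.mul_le_mul (excess_le fun v ↦ ?_) (excess_le fun v ↦ ?_)
        · have := hupper v
          omega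
        · have := hlower v
          simp only [Pi.neg_apply]
          omega
    _ = _ := by ring

/-- **Phase I (Lemma `PhaseI`).**
Suppose `p ∈ (0,1]` and `q ∈ [0,1)` satisfy `max{p, 1−q} ≥ θ/n` for a constant `θ > 0`, and
consider a random matching algorithm satisfying the `F`-fair condition on an edge-Markovian
evolving graph with parameters `p, q`, started from configuration `Γ₀` of discrepancy
`Δ ≥ 2`.  For any `0 < ε < 1/4` and any integer `T₁ ≥ (36·r/(c_*·F))·log(Δ·n/ε)`,
`Pr[ (max_v Γ_{T₁}(v) ≤ μ + 1) ∨ (max_v Γ̄_{T₁}(v) ≤ μ̄ + 1) ] ≥ 1 − ε²`,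
where `Γ̄_t(v) := K − Γ_t(v)` and `μ̄ := K − μ`. -/
theorem phase_one {V : Type} [Fintype V] [DecidableEq V] [Nonempty V]
    (θ : ℝ) (hθ : 0 < θ) (P : EMLoadProcess V)
    (hθn : θ / (Fintype.card V : ℝ) ≤ max P.p (1 - P.q))
    (F : ℝ) (hF0 : 0 < F) (hF1 : F ≤ 1) (hfair : P.Fair F)
    (Γ₀ : V → ℕ) (h0 : ∀ ω, P.Γ 0 ω = Γ₀) (hΔ : 2 ≤ disc Γ₀)
    (ε : ℝ) (hε0 : 0 < ε) (hε1 : ε < 1 / 4) (T₁ : ℕ)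
    (hT₁ : 36 * P.r / (cstar θ * F) *
        Real.log ((disc Γ₀ : ℝ) * (Fintype.card V : ℝ) / ε) ≤ (T₁ : ℝ)) :
    ENNReal.ofReal (1 - ε ^ 2) ≤
      P.μ {ω | (∀ v : V, (P.Γ T₁ ω v : ℝ) ≤ avgLoad Γ₀ + 1) ∨
        (∀ v : V, ((∑ u : V, Γ₀ u : ℕ) : ℝ) - (P.Γ T₁ ω v : ℝ) ≤
          (((∑ u : V, Γ₀ u : ℕ) : ℝ) - avgLoad Γ₀) + 1)} := by
  have hn : (1 : ℝ) ≤ Fintype.card V := by exact_mod_cast Fintype.card_pos (α := V)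
  have hD : (2 : ℝ) ≤ disc Γ₀ := by exact_mod_cast hΔ
  have hpot : (potential ⌊avgLoad Γ₀⌋₊ Γ₀ : ℝ) ≤ (Fintype.card V : ℝ) ^ 2 * (disc Γ₀ : ℝ) ^ 4 := by
    exact_mod_cast potential_floor_avgLoad_le Γ₀
  have hc := cstar_pos hθ
  have hr := P.one_le_r
  have hκn := P.le_card_mul_matchRate hθ hF0 hθn
  set m := ⌊avgLoad Γ₀⌋₊ with hm
  have havg : 0 ≤ avgLoad Γ₀ := by unfold avgLoad; positivity
  have hfloor : (m : ℝ) ≤ avgLoad Γ₀ := Nat.floor_le havg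
  have hfloor' : avgLoad Γ₀ < m + 1 := Nat.lt_floor_add_one _
  set κ := cstar θ * F / (8 * P.r) with hκ
  have hκ0 : 0 < κ := by positivity
  have hκ1 : κ ≤ 1 / 8 := by
    have hc1 : cstar θ ≤ 1 := (cstar_le hθ).trans (by
      rw [div_le_one (by positivity)]
      have : 0 < 1 / θ := by positivity
      linarith)
    rw [hκ, div_le_iff₀ (by positivity)]
    nlinarith
  set L := Real.log ((disc Γ₀ : ℝ) * (Fintype.card V : ℝ) / ε) with hL
  set D : ℝ := (disc Γ₀ : ℝ)
  set n : ℝ := (Fintype.card V : ℝ)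
  have hDn : 8 ≤ D * n / ε := by
    rw [le_div_iff₀ hε0]
    nlinarith
  have hL1 : 1 ≤ L := by
    rw [hL, Real.le_log_iff_exp_le (by positivity)]
    linarith [Real.exp_one_lt_d9]
  have hκT : 9 / 2 * L ≤ κ * T₁ := by
    calc 9 / 2 * L = κ * (36 * P.r / (cstar θ * F) * L) := by
          rw [hκ]
          field_simp
          norm_num
      _ ≤ κ * T₁ := mul_le_mul_of_nonneg_left hT₁ hκ0.le
  obtain _ | s := T₁
  · simp at hκT
    linarith
  have hmean : (P.meanPotential m (s + 1)).toReal ≤ ε ^ 2 := by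
    refine (P.toReal_meanPotential_le hF0 hfair hκn (by linarith) h0 m s).trans ?_
    have hpow : (1 - κ) ^ s ≤ (ε / (D * n)) ^ 4 := by
      calc (1 - κ) ^ s ≤ Real.exp (-κ) ^ s :=
            pow_le_pow_left₀ (by linarith) (Real.one_sub_le_exp_neg κ) s
        _ = Real.exp (s * -κ) := (Real.exp_nat_mul _ _).symm
        _ ≤ Real.exp ((4 : ℕ) * -L) := by
            push_cast at hκT ⊢
            exact Real.exp_le_exp.2 (by linarith)
        _ = (ε / (D * n)) ^ 4 := by
            rw [Real.exp_nat_mul, Real.exp_neg, hL, Real.exp_log (by positivity), inv_div]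
    calc _ ≤ (ε / (D * n)) ^ 4 * (n ^ 2 * D ^ 4) := by gcongr
      _ = ε ^ 4 / n ^ 2 := by field_simp
      _ ≤ ε ^ 4 := div_le_self (by positivity) (one_le_pow₀ hn)
      _ ≤ ε ^ 2 := pow_le_pow_of_le_one hε0.le (by linarith) (by norm_num)
  have hmeas : Measurable fun ω ↦ (potential m (P.Γ (s + 1) ω) : ENNReal) :=
    (P.measurable_load (s + 1) fun γ ↦ (potential m γ : ENNReal)).mono (P.hist_le _) le_rfl
  have hbad : P.μ {ω | 1 ≤ (potential m (P.Γ (s + 1) ω) : ENNReal)} ≤ ENNReal.ofReal (ε ^ 2) := by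
    have h := mul_meas_ge_le_lintegral (μ := P.μ) hmeas 1
    rw [one_mul] at h
    have hfin : P.meanPotential m (s + 1) ≠ ⊤ :=
      ne_top_of_le_ne_top (ENNReal.natCast_ne_top _) (P.meanPotential_le h0 m _)
    exact h.trans ((ENNReal.le_ofReal_iff_toReal_le hfin (by positivity)).2 hmean)
  have hbadm : MeasurableSet {ω | 1 ≤ (potential m (P.Γ (s + 1) ω) : ENNReal)} :=
    measurableSet_le measurable_const hmeas
  calc ENNReal.ofReal (1 - ε ^ 2) = 1 - ENNReal.ofReal (ε ^ 2) := by
        rw [ENNReal.ofReal_sub _ (by positivity), ENNReal.ofReal_one]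
    _ ≤ 1 - P.μ {ω | 1 ≤ (potential m (P.Γ (s + 1) ω) : ENNReal)} := tsub_le_tsub_left hbad 1
    _ = P.μ {ω | 1 ≤ (potential m (P.Γ (s + 1) ω) : ENNReal)}ᶜ := (prob_compl_eq_one_sub hbadm).symm
    _ ≤ _ := by
      refine measure_mono fun ω hω ↦ ?_
      have hzero : potential m (P.Γ (s + 1) ω) = 0 := by
        by_contra h
        exact hω (by simpa [Nat.one_le_iff_ne_zero] using h)
      rcases Nat.mul_eq_zero.1 hzero with h | h
      · refine Or.inl fun v ↦ ?_
        have hv : (P.Γ (s + 1) ω v : ℤ) ≤ m + 1 := excess_eq_zero h v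
        have : (P.Γ (s + 1) ω v : ℝ) ≤ m + 1 := by exact_mod_cast hv
        linarith
      · refine Or.inr fun v ↦ ?_
        have hv : -(P.Γ (s + 1) ω v : ℤ) ≤ -m := excess_eq_zero h v
        have : (m : ℝ) ≤ P.Γ (s + 1) ω v := by exact_mod_cast neg_le_neg_iff.1 hv
        linarith

end
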